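/- Let (X,d) be a compact metric space, f : X → X continuous with h_top(f) < +∞, and φ, ψ ∈ C(X,ℝ) with ψ > 0. Let F be a non-empty subset of M(X,f). Then F equals the set of equilibrium states of P_ψ(βφ) for all β ≥ 1 if and only if both of the following hold: (1) F is the set of equilibrium states of P_ψ(φ); (2) for all μ ∈ F, (∫φ dμ)/(∫ψ dμ) = sup_{ν ∈ M(X,f)} (∫φ dν)/(∫ψ dν). -/

import Mathlib

open Filter Set Topology MeasureTheory ENNReal

variable {X : Type*}

/-- Birkhoff sum `S_n φ = ∑_{i<n} φ ∘ f^i`. -/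
def birkhoff (f : X → X) (φ : X → ℝ) (n : ℕ) (x : X) : ℝ :=
  ∑ i ∈ Finset.range n, φ (f^[i] x)

section Metric
variable [MetricSpace X]

/-- `F` is an `(n,ε)`-spanning set of `Z`: every `y ∈ Z` is within Bowen distance
`d_n ≤ ε` of some point of `F`. -/
def IsSpanningSetOf (f : X → X) (n : ℕ) (ε : ℝ) (Z : Set X) (F : Finset X) : Prop :=
  ∀ y ∈ Z, ∃ x ∈ F, ∀ i < n, dist (f^[i] x) (f^[i] y) ≤ ε

/-- `E` is an `(n,ε)`-separated set of `Z`: `E ⊆ Z` and distinct points of `E` are at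
Bowen distance `d_n > ε`. -/
def IsSeparatedSetOf (f : X → X) (n : ℕ) (ε : ℝ) (Z : Set X) (E : Finset X) : Prop :=
  (E : Set X) ⊆ Z ∧ ∀ x ∈ E, ∀ y ∈ E, x ≠ y → ∃ i < n, ε < dist (f^[i] x) (f^[i] y)

/-- `S_T = {n : ℕ | ∃ x, S_nψ(x) ≤ T < S_{n+1}ψ(x)}`. -/
def inducedST (f : X → X) (ψ : X → ℝ) (T : ℝ) : Set ℕ :=
  {n | ∃ x : X, birkhoff f ψ n x ≤ T ∧ T < birkhoff f ψ (n + 1) x}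

/-- `X_n = {x | S_nψ(x) ≤ T < S_{n+1}ψ(x)}`. -/
def inducedXn (f : X → X) (ψ : X → ℝ) (T : ℝ) (n : ℕ) : Set X :=
  {x | birkhoff f ψ n x ≤ T ∧ T < birkhoff f ψ (n + 1) x}

/-- `Q_{ψ,T}(f,φ,ε)`: infimum over families of `(n,ε)`-spanning sets of the `X_n`, `n ∈ S_T`,
of `∑_{n ∈ S_T} ∑_{x ∈ F_n} e^{S_nφ(x)}`. -/
noncomputable def inducedQ (f : X → X) (ψ φ : X → ℝ) (T ε : ℝ) : ℝ≥0∞ :=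
  ⨅ (F : ℕ → Finset X) (_ : ∀ n ∈ inducedST f ψ T,
      IsSpanningSetOf f n ε (inducedXn f ψ T n) (F n)),
    ∑' n : inducedST f ψ T, ∑ x ∈ F n, ENNReal.ofReal (Real.exp (birkhoff f φ n x))

/-- `P_{ψ,T}(f,φ,ε)`: supremum over families of `(n,ε)`-separated sets of the `X_n`, `n ∈ S_T`,
of `∑_{n ∈ S_T} ∑_{x ∈ E_n} e^{S_nφ(x)}`. -/
noncomputable def inducedPsep (f : X → X) (ψ φ : X → ℝ) (T ε : ℝ) : ℝ≥0∞ :=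
  ⨆ (E : ℕ → Finset X) (_ : ∀ n ∈ inducedST f ψ T,
      IsSeparatedSetOf f n ε (inducedXn f ψ T n) (E n)),
    ∑' n : inducedST f ψ T, ∑ x ∈ E n, ENNReal.ofReal (Real.exp (birkhoff f φ n x))

/-- The ψ-induced topological pressure
`P_ψ(φ) = lim_{ε→0⁺} limsup_{T→∞} (1/T) log Q_{ψ,T}(f,φ,ε)`, the limit as `ε → 0⁺`
being realized as a `limsup` along `𝓝[>] 0` (since `ε ↦ limsup_T …` is monotone,
this coincides with the limit). -/
noncomputable def inducedPressure (f : X → X) (ψ φ : X → ℝ) : EReal :=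
  limsup (fun ε : ℝ =>
    limsup (fun T : ℝ => ENNReal.log (inducedQ f ψ φ T ε) * ((T⁻¹ : ℝ) : EReal)) atTop)
    (𝓝[>] (0 : ℝ))

/-- Topological entropy `h_top(f) = P_ψ(0)` with `ψ ≡ 1`. -/
noncomputable def topEntropy (f : X → X) : EReal :=
  inducedPressure f (fun _ => 1) (fun _ => 0)

end Metric
section Meas
variable [MetricSpace X] [MeasurableSpace X] [BorelSpace X]

/-- Entropy of the finite measurable partition of `X` induced by a map `q` into a finite
type: `H(q) = ∑_s -μ(q⁻¹{s}) log μ(q⁻¹{s})`. -/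
noncomputable def mapEntropy {S : Type*} [Fintype S] (μ : Measure X) (q : X → S) : ℝ :=
  ∑ s : S, Real.negMulLog ((μ (q ⁻¹' {s})).toReal)

/-- Kolmogorov–Sinai (measure-theoretic) entropy `h_μ(f)`: the supremum, over finite
measurable partitions (encoded as measurable maps `p : X → Fin k`), of
`lim_n (1/n) H(⋁_{i<n} f^{-i} p)`; the limit exists by subadditivity and is
realized here as a `liminf`. -/
noncomputable def measEntropy (f : X → X) (μ : Measure X) : EReal :=
  ⨆ (k : ℕ) (p : X → Fin k) (_ : Measurable p),
    liminf (fun n : ℕ =>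
      (((n : ℝ)⁻¹ * mapEntropy μ (fun x (i : Fin n) => p (f^[i] x)) : ℝ) : EReal)) atTop

/-- The set `M(X,f)` of `f`-invariant Borel probability measures on `X`. -/
def invMeasures (f : X → X) : Set (Measure X) :=
  {μ | IsProbabilityMeasure μ ∧ ∀ B : Set X, MeasurableSet B → μ (f ⁻¹' B) = μ B}

/-- `μ` is an equilibrium state of `P_ψ(φ)`:
`μ ∈ M(X,f)` and `P_ψ(φ) = (h_μ(f) + ∫φ dμ)/(∫ψ dμ)`. -/
noncomputable def equilibriumStates (f : X → X) (ψ φ : X → ℝ) : Set (Measure X) :=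
  {μ | μ ∈ invMeasures f ∧
    inducedPressure f ψ φ =
      (measEntropy f μ + ((∫ x, φ x ∂μ : ℝ) : EReal)) / (((∫ x, ψ x ∂μ : ℝ) : EReal))}

end Meas

section Freeze
variable [MetricSpace X] [MeasurableSpace X] [BorelSpace X]

/-- `Max^ψ(φ) = sup_{μ ∈ M(X,f)} (∫φ dμ)/(∫ψ dμ)`. -/
noncomputable def maxRatio (f : X → X) (ψ φ : X → ℝ) : ℝ :=
  ⨆ ν : invMeasures f, (∫ x, φ x ∂(ν : Measure X)) / (∫ x, ψ x ∂(ν : Measure X))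

/-- `M_max^ψ(φ) = {μ ∈ M(X,f) : (∫φ dμ)/(∫ψ dμ) = Max^ψ(φ)}`. -/
def maxSet (f : X → X) (ψ φ : X → ℝ) : Set (Measure X) :=
  {μ ∈ invMeasures f |
    (∫ x, φ x ∂μ) / (∫ x, ψ x ∂μ) = maxRatio f ψ φ}

/-- `h_∞^ψ(φ) = sup{h_μ(f)/(∫ψ dμ) : μ ∈ M_max^ψ(φ)}`. -/
noncomputable def hInfty (f : X → X) (ψ φ : X → ℝ) : EReal :=
  ⨆ μ : maxSet f ψ φ, measEntropy f (μ : Measure X) / (((∫ x, ψ x ∂(μ : Measure X) : ℝ)) : EReal)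

end Freeze

theorem sum_negMulLog_le {S : Type*} [Fintype S] (m w : S → ℝ) (hm : ∀ s, 0 ≤ m s)
    (hm1 : ∑ s, m s = 1) (hw : ∀ s, 0 < w s) {Z : ℝ} (hZ : ∑ s, w s ≤ Z) :
    ∑ s, Real.negMulLog (m s) + ∑ s, m s * Real.log (w s) ≤ Real.log Z := by
  have hne : Nonempty S := by
    by_contra h
    rw [not_nonempty_iff] at h
    simp at hm1
  have hZ0 : 0 < Z := (Finset.sum_pos (fun s _ => hw s) Finset.univ_nonempty).trans_le hZ
  have key : ∀ s, Real.negMulLog (m s) + m s * Real.log (w s) - m s * Real.log Z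
      ≤ w s / Z - m s := by
    intro s
    rcases (hm s).eq_or_lt with h | h
    · rw [← h]
      have := div_nonneg (hw s).le hZ0.le
      simpa using this
    · have h1 : Real.log (w s / (Z * m s)) ≤ w s / (Z * m s) - 1 :=
        Real.log_le_sub_one_of_pos (by have := hw s; positivity)
      rw [Real.log_div (hw s).ne' (by positivity), Real.log_mul hZ0.ne' h.ne'] at h1
      have h2 := mul_le_mul_of_nonneg_left h1 h.le
      have h3 : m s * (w s / (Z * m s) - 1) = w s / Z - m s := by field_simp
      rw [h3] at h2
      simp only [Real.negMulLog]
      linarith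
  have h := Finset.sum_le_sum (fun s (_ : s ∈ Finset.univ) => key s)
  rw [Finset.sum_sub_distrib, Finset.sum_add_distrib, Finset.sum_sub_distrib, ← Finset.sum_mul,
    ← Finset.sum_div, hm1] at h
  have : (∑ s, w s) / Z ≤ 1 := (div_le_one hZ0).2 hZ
  linarith

section Entropy
variable [MeasurableSpace X]

theorem mapEntropy_add_integral_le {S : Type*} [Fintype S] [MeasurableSpace S]
    [MeasurableSingletonClass S] (μ : Measure X) [IsProbabilityMeasure μ] {q : X → S}
    (hq : Measurable q) (w : S → ℝ) (hw : ∀ s, 0 < w s) {Z : ℝ} (hZ : ∑ s, w s ≤ Z)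
    {B : X → ℝ} (hB : Integrable B μ) (hle : ∀ y, B y ≤ Real.log (w (q y))) :
    mapEntropy μ q + ∫ y, B y ∂μ ≤ Real.log Z := by
  have : IsProbabilityMeasure (μ.map q) := Measure.isProbabilityMeasure_map hq.aemeasurable
  have hint : Integrable (fun s => Real.log (w s)) (μ.map q) := Integrable.of_finite
  have h1 : ∫ y, B y ∂μ ≤ ∫ y, Real.log (w (q y)) ∂μ :=
    integral_mono hB (hint.comp_measurable hq) hle
  have h2 : ∫ y, Real.log (w (q y)) ∂μ = ∑ s, (μ (q ⁻¹' {s})).toReal * Real.log (w s) := by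
    rw [← integral_map (f := fun s => Real.log (w s)) hq.aemeasurable hint.aestronglyMeasurable,
      integral_fintype hint]
    refine Finset.sum_congr rfl fun s _ => ?_
    rw [measureReal_def, Measure.map_apply hq (measurableSet_singleton s), smul_eq_mul]
  have h3 : ∑ s, (μ (q ⁻¹' {s})).toReal = 1 := by
    have : ∑ s, (μ.map q).real {s} = 1 := by simp
    rw [← this]
    refine Finset.sum_congr rfl fun s _ => ?_
    rw [measureReal_def, Measure.map_apply hq (measurableSet_singleton s)]
  have := sum_negMulLog_le _ w (fun s => ENNReal.toReal_nonneg) h3 hw hZ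
  rw [mapEntropy]
  linarith

end Entropy

section Itinerary
variable [MetricSpace X] [MeasurableSpace X]

/-- Entropy of the `N`-th itinerary of a partition `p` is bounded by a weighted spanning family,
via the code which predicts the itinerary of `y` from that of a Bowen-close centre, with
failure probability `κ` at each time. -/
theorem mapEntropy_itinerary_add_integral_le {ι : Type*} {f : X → X} {μ : Measure X}
    [IsProbabilityMeasure μ] (hf : MeasurePreserving f μ μ) {k : ℕ} {p : X → Fin k}
    (hp : Measurable p) {K : Set X} (hK : MeasurableSet K) {ε : ℝ}
    (hpK : ∀ y ∈ K, ∀ z ∈ K, dist y z ≤ 2 * ε → p y = p z) {κ : ℝ} (hκ0 : 0 < κ) (hκ1 : κ < 1)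
    (N : ℕ) (I : Finset ι) (c : ι → X) (a : ι → ℝ) (ha : ∀ i, 0 < a i) {A : X → ℝ}
    (hA : Integrable A μ)
    (hcov : ∀ y, ∃ i ∈ I, (∀ j < N, dist (f^[j] (c i)) (f^[j] y) ≤ ε) ∧ A y ≤ Real.log (a i)) :
    mapEntropy μ (fun x (i : Fin N) => p (f^[i] x)) + ∫ y, A y ∂μ ≤
      Real.log (∑ i ∈ I, a i) + N * (-Real.log (1 - κ) + μ.real Kᶜ * Real.log (k / κ)) := by
  classical
  obtain ⟨x₀⟩ : Nonempty X := nonempty_of_isProbabilityMeasure μ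
  have hk : (0 : ℝ) < k := by exact_mod_cast (p x₀).pos
  have hk1 : (1 : ℝ) ≤ k := by exact_mod_cast (p x₀).pos
  have hkne : (k : ℝ) ≠ 0 := hk.ne'
  set pr : X → Fin k := fun x => if h : ∃ y ∈ K, dist x y ≤ ε then p h.choose else p x with hpr
  have hpr_eq : ∀ x, ∀ y ∈ K, dist x y ≤ ε → pr x = p y := by
    intro x y hy hxy
    have h : ∃ y ∈ K, dist x y ≤ ε := ⟨y, hy, hxy⟩
    simp only [hpr, dif_pos h]
    refine hpK _ h.choose_spec.1 _ hy ?_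
    have := dist_triangle_left h.choose y x
    linarith [h.choose_spec.2]
  set v : X → Fin k → ℝ := fun x l => (if l = pr x then 1 - κ else 0) + κ / k with hv
  have hvpos : ∀ x l, κ / k ≤ v x l := by
    intro x l
    simp only [hv]
    split_ifs <;> linarith
  have hκk : 0 < κ / k := by positivity
  have hvsum : ∀ x, ∑ l, v x l = 1 := by
    intro x
    simp only [hv, Finset.sum_add_distrib, Finset.sum_ite_eq', Finset.mem_univ, if_true,
      Finset.sum_const, Finset.card_univ, Fintype.card_fin, nsmul_eq_mul]
    field_simp
    ring
  set w : (Fin N → Fin k) → ℝ := fun C => ∑ i ∈ I, a i * ∏ j : Fin N, v (f^[j] (c i)) (C j) with hw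
  have hterm : ∀ i (C : Fin N → Fin k), 0 < a i * ∏ j : Fin N, v (f^[j] (c i)) (C j) := fun i C =>
    mul_pos (ha i) (Finset.prod_pos fun j _ => hκk.trans_le (hvpos _ _))
  have hI : I.Nonempty := by
    obtain ⟨i, hi, -⟩ := hcov x₀
    exact ⟨i, hi⟩
  have hwpos : ∀ C, 0 < w C := fun C => Finset.sum_pos (fun i _ => hterm i C) hI
  have hwsum : ∑ C, w C = ∑ i ∈ I, a i := by
    simp only [hw]
    rw [Finset.sum_comm]
    refine Finset.sum_congr rfl fun i _ => ?_
    rw [← Finset.mul_sum, ← Fintype.prod_sum (fun (j : Fin N) l => v (f^[j] (c i)) l)]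
    simp [hvsum]
  set L : ℝ := Real.log (k / κ) with hL
  have hL0 : 0 ≤ L := Real.log_nonneg (by rw [le_div_iff₀ hκ0]; linarith)
  have hlogκ : Real.log (1 - κ) ≤ 0 := Real.log_nonpos (by linarith) (by linarith)
  set b : X → ℝ := fun y => Real.log (1 - κ) - Kᶜ.indicator (fun _ => L) y with hb
  have hbint : Integrable b μ :=
    (integrable_const _).sub ((integrable_const _).indicator hK.compl)
  have hbI : ∫ y, b y ∂μ = Real.log (1 - κ) - μ.real Kᶜ * L := by
    simp only [hb]
    rw [integral_sub (integrable_const _) ((integrable_const _).indicator hK.compl),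
      integral_indicator hK.compl]
    simp
  have hfj : ∀ j, MeasurePreserving (f^[j]) μ μ := fun j => hf.iterate j
  have hbjint : ∀ j, Integrable (fun y => b (f^[j] y)) μ := fun j =>
    (hfj j).integrable_comp_of_integrable hbint
  have hbjI : ∀ j, ∫ y, b (f^[j] y) ∂μ = ∫ y, b y ∂μ := by
    intro j
    have h := integral_map (μ := μ) (φ := f^[j]) (f := b) (hfj j).measurable.aemeasurable
      (by rw [(hfj j).map_eq]; exact hbint.aestronglyMeasurable)
    rw [(hfj j).map_eq] at h
    exact h.symm
  have hBint : Integrable (fun y => A y + ∑ j ∈ Finset.range N, b (f^[j] y)) μ :=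
    hA.add (integrable_finsetSum _ fun j _ => hbjint j)
  have hq : Measurable (fun x (i : Fin N) => p (f^[i] x)) :=
    measurable_pi_lambda _ fun i => hp.comp (hfj i).measurable
  have hle : ∀ y, A y + ∑ j ∈ Finset.range N, b (f^[j] y)
      ≤ Real.log (w (fun i : Fin N => p (f^[i] y))) := by
    intro y
    obtain ⟨i, hi, hd, hAi⟩ := hcov y
    have h1 : a i * ∏ j : Fin N, v (f^[j] (c i)) (p (f^[j] y))
        ≤ w (fun i : Fin N => p (f^[i] y)) :=
      Finset.single_le_sum (f := fun i => a i * ∏ j : Fin N, v (f^[j] (c i)) (p (f^[j] y)))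
        (fun i _ => (hterm i _).le) hi
    refine le_trans ?_ (Real.log_le_log (hterm i _) h1)
    have hprod : ∏ j : Fin N, v (f^[j] (c i)) (p (f^[j] y)) ≠ 0 :=
      Finset.prod_ne_zero_iff.2 fun j _ => (hκk.trans_le (hvpos _ _)).ne'
    rw [Real.log_mul (ha i).ne' hprod,
      Real.log_prod fun j _ => (hκk.trans_le (hvpos _ _)).ne', Finset.sum_range]
    refine add_le_add hAi (Finset.sum_le_sum fun j _ => ?_)
    simp only [hb]
    by_cases hy : f^[j] y ∈ K
    · have h2 : pr (f^[j] (c i)) = p (f^[j] y) := hpr_eq _ _ hy (hd j j.2)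
      simp only [hv, h2, if_true, Set.mem_compl_iff, hy, not_true, not_false_iff,
        Set.indicator_of_notMem, sub_zero]
      exact Real.log_le_log (by linarith) (by linarith)
    · have h3 : Real.log (κ / k) ≤ Real.log (v (f^[j] (c i)) (p (f^[j] y))) :=
        Real.log_le_log hκk (hvpos _ _)
      have h4 : Real.log (κ / k) = -L := by
        rw [hL, ← Real.log_inv, inv_div]
      rw [Set.indicator_of_mem (by exact hy)]
      linarith
  have := mapEntropy_add_integral_le μ hq w hwpos hwsum.le hBint hle
  rw [integral_add hA (integrable_finsetSum _ fun j _ => hbjint j),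
    integral_finsetSum _ fun j _ => hbjint j] at this
  simp only [hbjI, hbI, Finset.sum_const, Finset.card_range, nsmul_eq_mul] at this
  linarith

end Itinerary
theorem birkhoff_succ (f : X → X) (φ : X → ℝ) (n : ℕ) (x : X) :
    birkhoff f φ (n + 1) x = birkhoff f φ n x + φ (f^[n] x) :=
  Finset.sum_range_succ _ _

theorem mul_le_birkhoff {f : X → X} {φ : X → ℝ} {m : ℝ} (h : ∀ x, m ≤ φ x) (n : ℕ) (x : X) :
    n * m ≤ birkhoff f φ n x := by
  have := Finset.sum_le_sum (fun i (_ : i ∈ Finset.range n) => h (f^[i] x))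
  simpa [birkhoff] using this

theorem birkhoff_le_mul {f : X → X} {φ : X → ℝ} {C : ℝ} (h : ∀ x, φ x ≤ C) (n : ℕ) (x : X) :
    birkhoff f φ n x ≤ n * C := by
  have := Finset.sum_le_sum (fun i (_ : i ∈ Finset.range n) => h (f^[i] x))
  simpa [birkhoff] using this

theorem birkhoff_sub_const_mul (f : X → X) (φ ψ : X → ℝ) (c : ℝ) (n : ℕ) (x : X) :
    birkhoff f (fun y => φ y - c * ψ y) n x = birkhoff f φ n x - c * birkhoff f ψ n x := by
  simp [birkhoff, Finset.sum_sub_distrib, Finset.mul_sum]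

theorem mem_inducedXn_of_ceil {f : X → X} {ψ : X → ℝ} {m T₀ : ℝ} (hm : 0 < m)
    (hψm : ∀ x, m ≤ ψ x) {N : ℕ} {y : X} (hN : T₀ ≤ birkhoff f ψ N y) :
    let T := T₀ + m * ⌈(birkhoff f ψ N y - T₀) / m⌉₊
    y ∈ inducedXn f ψ T N ∧ |birkhoff f ψ N y - T| ≤ m := by
  intro T
  have h1 := Nat.le_ceil ((birkhoff f ψ N y - T₀) / m)
  have h2 := Nat.ceil_lt_add_one (div_nonneg (sub_nonneg.2 hN) hm.le)
  rw [div_le_iff₀ hm] at h1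
  rw [← sub_lt_iff_lt_add, lt_div_iff₀ hm] at h2
  have h3 : birkhoff f ψ N y ≤ T := by simp only [T]; linarith
  have h4 : T < birkhoff f ψ N y + m := by simp only [T]; linarith
  refine ⟨⟨h3, ?_⟩, ?_⟩
  · rw [birkhoff_succ]
    linarith [hψm (f^[N] y)]
  · rw [abs_le]
    constructor <;> linarith

section Pressure
variable [MetricSpace X]

theorem abs_birkhoff_sub_le {f : X → X} {φ : X → ℝ} {ε η : ℝ}
    (h : ∀ x y, dist x y ≤ ε → |φ x - φ y| ≤ η) {n : ℕ} {x y : X}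
    (hxy : ∀ i < n, dist (f^[i] x) (f^[i] y) ≤ ε) :
    |birkhoff f φ n x - birkhoff f φ n y| ≤ n * η := by
  rw [birkhoff, birkhoff, ← Finset.sum_sub_distrib]
  refine (Finset.abs_sum_le_sum_abs _ _).trans ?_
  have := Finset.sum_le_sum
    (fun i (hi : i ∈ Finset.range n) => h _ _ (hxy i (Finset.mem_range.1 hi)))
  simpa using this

theorem eventually_forall_dist_le_abs_sub_le [CompactSpace X] {φ : X → ℝ} (hφ : Continuous φ)
    {η : ℝ} (hη : 0 < η) :
    ∀ᶠ ε in 𝓝[>] (0 : ℝ), ∀ x y, dist x y ≤ ε → |φ x - φ y| ≤ η := by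
  obtain ⟨δ, hδ, h⟩ := Metric.uniformContinuous_iff.1
    (CompactSpace.uniformContinuous_of_continuous hφ) η hη
  filter_upwards [Ioo_mem_nhdsGT hδ] with ε hε x y hxy
  exact (h (hxy.trans_lt hε.2)).le

theorem exists_pos_forall_abs_le [CompactSpace X] {φ : X → ℝ} (hφ : Continuous φ) :
    ∃ C > 0, ∀ x, |φ x| ≤ C := by
  obtain ⟨C, hC⟩ := isCompact_univ.exists_bound_of_continuousOn hφ.continuousOn
  exact ⟨max C 1, by positivity, fun x => (hC x (mem_univ x)).trans (le_max_left _ _)⟩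

theorem exists_pos_forall_le [CompactSpace X] [Nonempty X] {ψ : X → ℝ} (hψ : Continuous ψ)
    (hpos : ∀ x, 0 < ψ x) : ∃ m > 0, ∀ x, m ≤ ψ x := by
  obtain ⟨x, -, hx⟩ := isCompact_univ.exists_isMinOn univ_nonempty hψ.continuousOn
  exact ⟨ψ x, hpos x, fun y => hx (mem_univ y)⟩

theorem eventually_inducedQ_lt {f : X → X} {ψ φ : X → ℝ} {c : ℝ}
    (h : inducedPressure f ψ φ < c) :
    ∀ᶠ ε in 𝓝[>] (0 : ℝ), ∀ᶠ T in atTop,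
      inducedQ f ψ φ T ε < ENNReal.ofReal (Real.exp (c * T)) := by
  filter_upwards [eventually_lt_of_limsup_lt h] with ε hε
  filter_upwards [eventually_lt_of_limsup_lt hε, eventually_gt_atTop 0] with T hT hT0
  rw [← ENNReal.log_lt_log_iff, ENNReal.log_ofReal_of_pos (Real.exp_pos _), Real.log_exp]
  have h1 : ENNReal.log (inducedQ f ψ φ T ε) / (T : EReal) < c := by
    rwa [EReal.div_eq_inv_mul, mul_comm, ← EReal.coe_inv]
  rwa [EReal.div_lt_iff (by exact_mod_cast hT0) (EReal.coe_ne_top T), ← EReal.coe_mul] at h1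

theorem inducedPressure_le {f : X → X} {ψ φ : X → ℝ} {c : ℝ}
    (h : ∀ᶠ ε in 𝓝[>] (0 : ℝ), ∀ᶠ T in atTop,
      inducedQ f ψ φ T ε ≤ ENNReal.ofReal (Real.exp (c * T))) :
    inducedPressure f ψ φ ≤ c := by
  refine limsup_le_of_le (h := ?_)
  filter_upwards [h] with ε hε
  refine limsup_le_of_le (h := ?_)
  filter_upwards [hε, eventually_gt_atTop 0] with T hT hT0
  rw [← ENNReal.log_le_log_iff, ENNReal.log_ofReal_of_pos (Real.exp_pos _), Real.log_exp] at hT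
  have h1 : ENNReal.log (inducedQ f ψ φ T ε) / (T : EReal) ≤ c := by
    rw [EReal.div_le_iff_le_mul (by exact_mod_cast hT0) (EReal.coe_ne_top T), ← EReal.coe_mul,
      mul_comm]
    exact hT
  rwa [EReal.div_eq_inv_mul, mul_comm, ← EReal.coe_inv] at h1

/-- A family of spanning sets almost realizing `inducedQ`, all of whose points shadow a point
of `X_n`. -/
theorem exists_spanning_of_inducedQ_lt {f : X → X} {ψ φ : X → ℝ} {T ε : ℝ} {a : ℝ≥0∞}
    (h : inducedQ f ψ φ T ε < a) :
    ∃ F : ℕ → Finset X,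
      (∀ n ∈ inducedST f ψ T, IsSpanningSetOf f n ε (inducedXn f ψ T n) (F n)) ∧
      (∀ n, ∀ x ∈ F n, ∃ y ∈ inducedXn f ψ T n, ∀ i < n, dist (f^[i] x) (f^[i] y) ≤ ε) ∧
      ∑' n : inducedST f ψ T, ∑ x ∈ F n, ENNReal.ofReal (Real.exp (birkhoff f φ n x)) < a := by
  classical
  rw [inducedQ, iInf_lt_iff] at h
  obtain ⟨F, h⟩ := h
  rw [iInf_lt_iff] at h
  obtain ⟨hF, h⟩ := h
  refine ⟨fun n => (F n).filter
    fun x => ∃ y ∈ inducedXn f ψ T n, ∀ i < n, dist (f^[i] x) (f^[i] y) ≤ ε, ?_, ?_, ?_⟩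
  · intro n hn y hy
    obtain ⟨x, hx, hxy⟩ := hF n hn y hy
    exact ⟨x, Finset.mem_filter.2 ⟨hx, y, hy, hxy⟩, hxy⟩
  · intro n x hx
    exact (Finset.mem_filter.1 hx).2
  · refine lt_of_le_of_lt (ENNReal.tsum_le_tsum fun n => ?_) h
    exact Finset.sum_le_sum_of_subset (Finset.filter_subset _ _)

theorem exists_spanning_inducedXn {f : X → X} {ψ φ : X → ℝ} {T ε : ℝ} {r : ℝ} (hr : 0 ≤ r)
    (h : inducedQ f ψ φ T ε < ENNReal.ofReal r) (n : ℕ) :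
    ∃ E : Finset X, IsSpanningSetOf f n ε (inducedXn f ψ T n) E ∧
      ∑ x ∈ E, Real.exp (birkhoff f φ n x) ≤ r := by
  obtain ⟨F, hF, -, hlt⟩ := exists_spanning_of_inducedQ_lt h
  by_cases hn : n ∈ inducedST f ψ T
  · refine ⟨F n, hF n hn, ?_⟩
    have h1 := (ENNReal.le_tsum (f := fun n : inducedST f ψ T =>
      ∑ x ∈ F n, ENNReal.ofReal (Real.exp (birkhoff f φ n x))) ⟨n, hn⟩).trans hlt.le
    simp only at h1
    rwa [← ENNReal.ofReal_sum_of_nonneg fun _ _ => (Real.exp_pos _).le,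
      ENNReal.ofReal_le_ofReal_iff hr] at h1
  · exact ⟨∅, fun y hy => absurd ⟨y, hy⟩ hn, by simpa using hr⟩

end Pressure

section Invariance
variable [MeasurableSpace X]

theorem integral_comp_iterate {f : X → X} {μ : Measure X} (hf : MeasurePreserving f μ μ)
    {φ : X → ℝ} (hφ : Integrable φ μ) (j : ℕ) : ∫ y, φ (f^[j] y) ∂μ = ∫ y, φ y ∂μ := by
  have hfj := hf.iterate j
  have h := integral_map (μ := μ) (φ := f^[j]) (f := φ) hfj.measurable.aemeasurable
    (by rw [hfj.map_eq]; exact hφ.aestronglyMeasurable)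
  rw [hfj.map_eq] at h
  exact h.symm

theorem integrable_birkhoff {f : X → X} {μ : Measure X} (hf : MeasurePreserving f μ μ)
    {φ : X → ℝ} (hφ : Integrable φ μ) (n : ℕ) : Integrable (birkhoff f φ n) μ :=
  integrable_finsetSum _ fun j _ => (hf.iterate j).integrable_comp_of_integrable hφ

theorem integral_birkhoff {f : X → X} {μ : Measure X} (hf : MeasurePreserving f μ μ)
    {φ : X → ℝ} (hφ : Integrable φ μ) (n : ℕ) :
    ∫ y, birkhoff f φ n y ∂μ = n * ∫ y, φ y ∂μ := by
  have hj : ∀ j, Integrable (fun y => φ (f^[j] y)) μ := fun j =>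
    (hf.iterate j).integrable_comp_of_integrable hφ
  simp only [birkhoff]
  rw [integral_finsetSum _ fun j _ => hj j]
  simp [integral_comp_iterate hf hφ]

end Invariance

section VariationalInequality
variable [MetricSpace X] [MeasurableSpace X] [BorelSpace X]

theorem measurePreserving_of_mem_invMeasures {f : X → X} (hf : Continuous f) {μ : Measure X}
    (hμ : μ ∈ invMeasures f) : MeasurePreserving f μ μ :=
  ⟨hf.measurable, by
    ext B hB
    rw [Measure.map_apply hf.measurable hB, hμ.2 B hB]⟩

theorem integrable_of_continuous [CompactSpace X] (μ : Measure X) [IsFiniteMeasure μ] {φ : X → ℝ}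
    (hφ : Continuous φ) : Integrable φ μ :=
  hφ.integrable_of_hasCompactSupport (HasCompactSupport.of_compactSpace φ)

/-- A finite measurable partition is continuous (indeed uniformly locally constant) on a compact
set of almost full measure. -/
theorem exists_measurableSet_forall_dist_le_eq [CompactSpace X] (μ : Measure X)
    [IsProbabilityMeasure μ] {k : ℕ} {p : X → Fin k} (hp : Measurable p) {η : ℝ} (hη : 0 < η) :
    ∃ K : Set X, MeasurableSet K ∧ μ.real Kᶜ ≤ η ∧
      ∀ᶠ ε in 𝓝[>] (0 : ℝ), ∀ y ∈ K, ∀ z ∈ K, dist y z ≤ 2 * ε → p y = p z := by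
  have hkη : ENNReal.ofReal (η / (k + 1)) ≠ 0 := by
    rw [ne_eq, ENNReal.ofReal_eq_zero, not_le]
    positivity
  have h := fun i : Fin k => (hp (measurableSet_singleton i)).exists_isClosed_sdiff_lt
    (measure_ne_top μ _) hkη
  choose C hCsub hCclosed hCμ using h
  refine ⟨⋃ i, C i, (isClosed_iUnion_of_finite hCclosed).measurableSet, ?_, ?_⟩
  · have hsub : (⋃ i, C i)ᶜ ⊆ ⋃ i, (p ⁻¹' {i}) \ C i := by
      intro y hy
      simp only [Set.mem_compl_iff, Set.mem_iUnion, not_exists] at hy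
      exact Set.mem_iUnion.2 ⟨p y, rfl, hy _⟩
    have h1 : μ (⋃ i, C i)ᶜ ≤ ENNReal.ofReal η := by
      calc μ (⋃ i, C i)ᶜ ≤ μ (⋃ i, (p ⁻¹' {i}) \ C i) := measure_mono hsub
        _ ≤ ∑ i, μ ((p ⁻¹' {i}) \ C i) := measure_iUnion_fintype_le _ _
        _ ≤ ∑ _i : Fin k, ENNReal.ofReal (η / (k + 1)) := Finset.sum_le_sum fun i _ => (hCμ i).le
        _ = ENNReal.ofReal (k * (η / (k + 1))) := by
          rw [ENNReal.ofReal_mul (by positivity)]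
          simp
        _ ≤ ENNReal.ofReal η := by
          refine ENNReal.ofReal_le_ofReal ?_
          rw [mul_div_assoc', div_le_iff₀ (by positivity)]
          linarith
    exact ENNReal.toReal_le_of_le_ofReal hη.le h1
  · have hpair : ∀ i j : Fin k, ∀ᶠ ε in 𝓝[>] (0 : ℝ), ∀ y ∈ C i, ∀ z ∈ C j,
        dist y z ≤ 2 * ε → i = j := by
      intro i j
      by_cases hij : i = j
      · exact Eventually.of_forall fun _ _ _ _ _ _ => hij
      · have hd : Disjoint (C i) (C j) := by
          rw [Set.disjoint_left]
          intro y hy hy'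
          exact hij ((hCsub i hy : p y = i).symm.trans (hCsub j hy' : p y = j))
        obtain ⟨r, hr, hr'⟩ :=
          Metric.exists_pos_forall_lt_edist (hCclosed i).isCompact (hCclosed j) hd
        have hr0 : (0 : ℝ) < r / 2 := by positivity
        filter_upwards [Ioo_mem_nhdsGT hr0] with ε hε y hy z hz hyz
        exfalso
        have h2 := hr' y hy z hz
        rw [edist_nndist, ENNReal.coe_lt_coe, ← NNReal.coe_lt_coe, coe_nndist] at h2
        linarith [hε.2]
    filter_upwards [eventually_all.2 fun i => eventually_all.2 (hpair i)] with ε hε y hy z hz hyz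
    obtain ⟨i, hi⟩ := Set.mem_iUnion.1 hy
    obtain ⟨j, hj⟩ := Set.mem_iUnion.1 hz
    rw [(hCsub i hi : p y = i), (hCsub j hj : p z = j)]
    exact hε i j y hi z hj hyz

/-- The inequality `(h_μ(f) + ∫φ dμ) / ∫ψ dμ ≤ P_ψ(φ)`, in multiplied-out form. -/
theorem measEntropy_le_of_inducedPressure_lt [CompactSpace X] [Nonempty X] {f : X → X}
    (hf : Continuous f) {φ ψ : X → ℝ} (hφ : Continuous φ) (hψ : Continuous ψ)
    (hψpos : ∀ x, 0 < ψ x) {μ : Measure X} (hμ : μ ∈ invMeasures f) {c : ℝ}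
    (hc : inducedPressure f ψ φ < c) :
    measEntropy f μ ≤ ((c * ∫ x, ψ x ∂μ - ∫ x, φ x ∂μ : ℝ) : EReal) := by
  have := hμ.1
  have hmp := measurePreserving_of_mem_invMeasures hf hμ
  have hφi := integrable_of_continuous μ hφ
  have hψi := integrable_of_continuous μ hψ
  obtain ⟨m, hm, hψm⟩ := exists_pos_forall_le hψ hψpos
  obtain ⟨C, hC, hψC⟩ := exists_pos_forall_abs_le hψ
  refine iSup_le fun k => iSup_le fun p => iSup_le fun hp => ?_
  refine EReal.le_of_forall_lt_iff_le.1 fun z hz => ?_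
  rw [EReal.coe_lt_coe_iff] at hz
  obtain ⟨η, hη, hηz⟩ : ∃ η > 0, c * ∫ x, ψ x ∂μ - ∫ x, φ x ∂μ + 5 * η ≤ z :=
    ⟨(z - (c * ∫ x, ψ x ∂μ - ∫ x, φ x ∂μ)) / 5, by linarith, by linarith⟩
  set κ : ℝ := 1 - Real.exp (-η) with hκ
  have hκ0 : 0 < κ := by
    have : Real.exp (-η) < 1 := Real.exp_lt_one_iff.2 (by linarith)
    linarith
  have hκ1 : κ < 1 := by linarith [Real.exp_pos (-η)]
  have hlogκ : -Real.log (1 - κ) = η := by simp [hκ]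
  set L : ℝ := |Real.log (k / κ)| + 1 with hL
  have hL0 : 0 < L := by positivity
  obtain ⟨K, hKm, hKμ, hKε⟩ := exists_measurableSet_forall_dist_le_eq μ hp (div_pos hη hL0)
  obtain ⟨ε, hεK, hεφ, hεQ⟩ := (hKε.and ((eventually_forall_dist_le_abs_sub_le hφ hη).and
    (eventually_inducedQ_lt hc))).exists
  obtain ⟨T₀, hT₀⟩ := eventually_atTop.1 hεQ
  choose E hEspan hEsum using fun j : ℕ => exists_spanning_inducedXn (Real.exp_pos _).le
    (hT₀ (T₀ + m * j) (by have := hm.le; have : 0 ≤ m * j := by positivity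
                          linarith))
  have hKL : μ.real Kᶜ * Real.log (k / κ) ≤ η := by
    calc μ.real Kᶜ * Real.log (k / κ) ≤ μ.real Kᶜ * L :=
          mul_le_mul_of_nonneg_left ((le_abs_self _).trans (by linarith)) measureReal_nonneg
      _ ≤ η / L * L := mul_le_mul_of_nonneg_right hKμ hL0.le
      _ = η := by field_simp
  -- the bound at a fixed time `N`
  have hN : ∀ N : ℕ, T₀ ≤ N * m →
      mapEntropy μ (fun x (i : Fin N) => p (f^[i] x)) ≤
        Real.log (⌈(N * C - T₀) / m⌉₊ + 1) + N * (c * ∫ x, ψ x ∂μ - ∫ x, φ x ∂μ + 3 * η)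
          + |c| * m := by
    intro N hNT
    set J := ⌈(N * C - T₀) / m⌉₊ with hJ
    have hcov : ∀ y, ∃ i ∈ (Finset.range (J + 1)).sigma fun j => E j N,
        (∀ j < N, dist (f^[j] i.2) (f^[j] y) ≤ ε) ∧
        birkhoff f φ N y - c * birkhoff f ψ N y - (N * η + |c| * m) ≤
          Real.log (Real.exp (birkhoff f φ N i.2 - c * (T₀ + m * i.1))) := by
      intro y
      obtain ⟨hy, hyT⟩ := mem_inducedXn_of_ceil hm hψm
        (hNT.trans (mul_le_birkhoff hψm N y))
      set j := ⌈(birkhoff f ψ N y - T₀) / m⌉₊ with hj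
      obtain ⟨x, hx, hxy⟩ := hEspan j N y hy
      have hjJ : j ≤ J := by
        refine Nat.ceil_le_ceil ?_
        gcongr
        exact birkhoff_le_mul (fun x => (le_abs_self _).trans (hψC x)) N y
      refine ⟨⟨j, x⟩, ?_, hxy, ?_⟩
      · rw [Finset.mem_sigma]
        exact ⟨Finset.mem_range.2 (Nat.lt_succ_of_le hjJ), hx⟩
      · rw [Real.log_exp]
        have h1 := (abs_le.1 (abs_birkhoff_sub_le hεφ hxy)).1
        have h2 : -(c * (birkhoff f ψ N y - (T₀ + m * j))) ≤ |c| * m := by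
          refine (neg_le_abs _).trans ?_
          rw [abs_mul]
          exact mul_le_mul_of_nonneg_left hyT (abs_nonneg c)
        simp only
        linarith
    have hφN := integrable_birkhoff hmp hφi N
    have hψN := integrable_birkhoff hmp hψi N
    have hcψN : Integrable (fun y => c * birkhoff f ψ N y) μ := hψN.const_mul c
    have hφψN : Integrable (fun y => birkhoff f φ N y - c * birkhoff f ψ N y) μ := hφN.sub hcψN
    have hAN : Integrable
        (fun y => birkhoff f φ N y - c * birkhoff f ψ N y - (N * η + |c| * m)) μ :=
      hφψN.sub (integrable_const _)
    have h := mapEntropy_itinerary_add_integral_le hmp hp hKm hεK hκ0 hκ1 N _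
      (fun i : Σ _ : ℕ, X => i.2) _ (fun i => Real.exp_pos _)
      hAN hcov
    have hI : ∫ y, (birkhoff f φ N y - c * birkhoff f ψ N y - (N * η + |c| * m)) ∂μ =
        N * (∫ x, φ x ∂μ) - c * (N * ∫ x, ψ x ∂μ) - (N * η + |c| * m) := by
      rw [integral_sub hφψN (integrable_const _), integral_sub hφN hcψN, integral_const_mul, integral_birkhoff hmp hφi,
        integral_birkhoff hmp hψi]
      simp
    rw [hI, Finset.sum_sigma, hlogκ] at h
    have hsum : ∑ j ∈ Finset.range (J + 1), ∑ x ∈ E j N,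
        Real.exp (birkhoff f φ N x - c * (T₀ + m * j)) ≤ J + 1 := by
      calc _ ≤ ∑ j ∈ Finset.range (J + 1), (1 : ℝ) := by
            refine Finset.sum_le_sum fun j _ => ?_
            simp_rw [Real.exp_sub]
            rw [← Finset.sum_div, div_le_one (Real.exp_pos _)]
            exact hEsum j N
        _ = J + 1 := by simp
    have hsum0 : 0 < ∑ j ∈ Finset.range (J + 1), ∑ x ∈ E j N,
        Real.exp (birkhoff f φ N x - c * (T₀ + m * j)) := by
      obtain ⟨y⟩ := ‹Nonempty X›
      obtain ⟨i, hi, -⟩ := hcov y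
      rw [← Finset.sum_sigma (Finset.range (J + 1)) (fun j => E j N)
        (fun i => Real.exp (birkhoff f φ N i.2 - c * (T₀ + m * i.1)))]
      exact Finset.sum_pos (fun _ _ => Real.exp_pos _) ⟨i, hi⟩
    have hlog := Real.log_le_log hsum0 hsum
    have hNη : N * (η + μ.real Kᶜ * Real.log (k / κ)) ≤ N * (η + η) :=
      mul_le_mul_of_nonneg_left (by linarith) (Nat.cast_nonneg N)
    linarith
  -- letting `N` tend to infinity
  refine liminf_le_of_frequently_le' (Eventually.frequently ?_)
  have hη' : 0 < η * m / C := by positivity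
  have hlin : Tendsto (fun N : ℕ => (N * C + |T₀|) / m + 2) atTop atTop := by
    refine tendsto_atTop_add_const_right _ _ (Tendsto.atTop_div_const hm ?_)
    exact tendsto_atTop_add_const_right _ _ (tendsto_natCast_atTop_atTop.atTop_mul_const hC)
  have hlogo := hlin.eventually (Real.isLittleO_log_id_atTop.bound hη')
  have hbig : ∀ D : ℝ, ∀ b > 0, ∀ᶠ N : ℕ in atTop, D ≤ N * b := fun D b hb =>
    (tendsto_natCast_atTop_atTop.atTop_mul_const hb).eventually_ge_atTop D
  filter_upwards [hlogo, hbig T₀ m hm,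
    hbig (η * m / C * (|T₀| / m + 2) + |c| * m) η hη, eventually_gt_atTop 0]
    with N h1 h2 h3 hN0
  rw [EReal.coe_le_coe_iff]
  have hNpos : (0 : ℝ) < N := by exact_mod_cast hN0
  rw [inv_mul_le_iff₀ hNpos]
  refine (hN N h2).trans ?_
  have hceil : (⌈(N * C - T₀) / m⌉₊ : ℝ) + 1 ≤ (N * C + |T₀|) / m + 2 := by
    have h4 : (⌈(N * C - T₀) / m⌉₊ : ℝ) ≤ ⌈(N * C + |T₀|) / m⌉₊ := by
      refine Nat.cast_le.2 (Nat.ceil_le_ceil ?_)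
      gcongr
      linarith [neg_abs_le T₀]
    have h5 := Nat.ceil_lt_add_one (a := (N * C + |T₀|) / m) (by positivity)
    linarith
  have hlog1 : Real.log (⌈(N * C - T₀) / m⌉₊ + 1) ≤ Real.log ((N * C + |T₀|) / m + 2) :=
    Real.log_le_log (by positivity) hceil
  have hlog2 : Real.log ((N * C + |T₀|) / m + 2) ≤ η * m / C * ((N * C + |T₀|) / m + 2) := by
    refine (le_abs_self _).trans (h1.trans (le_of_eq ?_))
    simp only [id, Real.norm_eq_abs]
    rw [abs_of_nonneg (by positivity)]
  have hexp : η * m / C * ((N * C + |T₀|) / m + 2) = N * η + η * m / C * (|T₀| / m + 2) := by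
    field_simp
    ring
  have hz' := mul_le_mul_of_nonneg_left hηz hNpos.le
  linarith

end VariationalInequality
theorem birkhoff_comp_sub (f : X → X) (h : X → ℝ) (n : ℕ) (x : X) :
    birkhoff f (fun y => h (f y)) n x = birkhoff f h n x + (h (f^[n] x) - h x) := by
  have := Finset.sum_range_sub (fun i => h (f^[i] x)) n
  rw [Finset.sum_sub_distrib] at this
  simp only [birkhoff, ← Function.iterate_succ_apply' f]
  simp only [Function.iterate_zero, id] at this
  linarith

section EmpiricalMeasure
variable [MeasurableSpace X]

/-- The empirical measure `(n+1)⁻¹ ∑_{i ≤ n} δ_{f^i x}`. -/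
noncomputable def empiricalMeasure (f : X → X) (n : ℕ) (x : X) : Measure X :=
  ((n + 1 : ℕ) : ℝ≥0∞)⁻¹ • ∑ i ∈ Finset.range (n + 1), Measure.dirac (f^[i] x)

theorem isProbabilityMeasure_empiricalMeasure (f : X → X) (n : ℕ) (x : X) :
    IsProbabilityMeasure (empiricalMeasure f n x) := by
  refine ⟨?_⟩
  rw [empiricalMeasure, Measure.smul_apply, Measure.finsetSum_apply]
  simp only [measure_univ, Finset.sum_const, Finset.card_range, nsmul_eq_mul, mul_one, smul_eq_mul]
  exact ENNReal.inv_mul_cancel (by simp) (ENNReal.natCast_ne_top _)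

variable [MetricSpace X] [BorelSpace X]

theorem integral_empiricalMeasure [CompactSpace X] (f : X → X) (n : ℕ) (x : X) {h : X → ℝ}
    (hh : Continuous h) :
    ∫ y, h y ∂(empiricalMeasure f n x) = ((n : ℝ) + 1)⁻¹ * birkhoff f h (n + 1) x := by
  rw [empiricalMeasure, integral_smul_measure,
    integral_finsetSum_measure fun i _ => integrable_of_continuous _ hh]
  simp only [integral_dirac, smul_eq_mul, birkhoff]
  congr 1
  rw [ENNReal.toReal_inv, ENNReal.toReal_natCast]
  push_cast
  rfl

/-- A Krylov–Bogolyubov argument: Birkhoff averages are asymptotically bounded by integrals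
against invariant measures. -/
theorem eventually_birkhoff_succ_le [CompactSpace X] {f : X → X} (hf : Continuous f) {g : X → ℝ}
    (hg : Continuous g) (hgM : ∀ ν ∈ invMeasures f, ∫ y, g y ∂ν ≤ 0) {η : ℝ} (hη : 0 < η) :
    ∀ᶠ n : ℕ in atTop, ∀ x, birkhoff f g (n + 1) x ≤ (n + 1) * η := by
  by_contra hcon
  have hfreq : ∃ᶠ n : ℕ in atTop, ∃ x, (n + 1) * η < birkhoff f g (n + 1) x := by
    simpa only [not_eventually, not_forall, not_le] using hcon
  have : NeBot (atTop ⊓ 𝓟 {n : ℕ | ∃ x, (n + 1) * η < birkhoff f g (n + 1) x}) :=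
    frequently_mem_iff_neBot.1 hfreq
  have : Nonempty X := ⟨hfreq.exists.choose_spec.choose⟩
  choose! x hx using fun (n : ℕ) (h : ∃ x, (n + 1) * η < birkhoff f g (n + 1) x) => h
  let 𝒰 := Ultrafilter.of (atTop ⊓ 𝓟 {n : ℕ | ∃ x, (n + 1) * η < birkhoff f g (n + 1) x})
  have h𝒰 := Ultrafilter.of_le (atTop ⊓ 𝓟 {n : ℕ | ∃ x, (n + 1) * η < birkhoff f g (n + 1) x})
  have h𝒰top : (𝒰 : Filter ℕ) ≤ atTop := h𝒰.trans inf_le_left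
  have h𝒰x : ∀ᶠ n : ℕ in 𝒰, (n + 1) * η < birkhoff f g (n + 1) (x n) := by
    have h1 : ∀ᶠ n : ℕ in 𝒰, ∃ x, (n + 1) * η < birkhoff f g (n + 1) x :=
      (h𝒰.trans inf_le_right) (mem_principal_self _)
    exact h1.mono hx
  let P : ℕ → ProbabilityMeasure X := fun n =>
    ⟨empiricalMeasure f n (x n), isProbabilityMeasure_empiricalMeasure f n (x n)⟩
  obtain ⟨ν, hν⟩ : ∃ ν, Tendsto P 𝒰 (𝓝 ν) := ⟨(𝒰.map P).lim, (𝒰.map P).le_nhds_lim⟩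
  have hlim : ∀ h : X → ℝ, Continuous h → Tendsto
      (fun n : ℕ => ((n : ℝ) + 1)⁻¹ * birkhoff f h (n + 1) (x n)) 𝒰
      (𝓝 (∫ y, h y ∂(ν : Measure X))) := by
    intro h hh
    have h1 := ProbabilityMeasure.tendsto_iff_forall_integral_tendsto.1 hν
      (BoundedContinuousFunction.mkOfCompact ⟨h, hh⟩)
    refine h1.congr fun n => ?_
    exact integral_empiricalMeasure f n (x n) hh
  have hinv : ∀ h : X → ℝ, Continuous h →
      ∫ y, h (f y) ∂(ν : Measure X) = ∫ y, h y ∂(ν : Measure X) := by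
    intro h hh
    obtain ⟨D, hD, hhD⟩ := exists_pos_forall_abs_le hh
    have h1 := (hlim (fun y => h (f y)) (hh.comp hf)).sub (hlim h hh)
    have h2 : Tendsto (fun n : ℕ => ((n : ℝ) + 1)⁻¹ * birkhoff f (fun y => h (f y)) (n + 1) (x n)
        - ((n : ℝ) + 1)⁻¹ * birkhoff f h (n + 1) (x n)) 𝒰 (𝓝 0) := by
      have h3 : Tendsto (fun n : ℕ => ((n : ℝ) + 1)⁻¹ * (2 * D)) 𝒰 (𝓝 0) := by
        have h4 : Tendsto (fun n : ℕ => 1 / ((n : ℝ) + 1)) 𝒰 (𝓝 0) :=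
          tendsto_one_div_add_atTop_nhds_zero_nat.mono_left h𝒰top
        simpa using h4.mul_const (2 * D)
      refine squeeze_zero_norm (fun n => ?_) h3
      rw [birkhoff_comp_sub, ← mul_sub, add_sub_cancel_left, norm_mul, Real.norm_eq_abs,
        Real.norm_eq_abs, abs_of_nonneg (by positivity : (0 : ℝ) ≤ ((n : ℝ) + 1)⁻¹)]
      refine mul_le_mul_of_nonneg_left ((abs_sub _ _).trans ?_) (by positivity)
      linarith [hhD (f^[n + 1] (x n)), hhD (x n)]
    linarith [tendsto_nhds_unique h1 h2]
  have hmap : (ν : Measure X).map f = ν := by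
    have : IsProbabilityMeasure ((ν : Measure X).map f) :=
      Measure.isProbabilityMeasure_map hf.aemeasurable
    refine ext_of_forall_integral_eq_of_IsFiniteMeasure fun h => ?_
    rw [integral_map hf.aemeasurable h.continuous.aestronglyMeasurable]
    exact hinv h h.continuous
  have hνM : (ν : Measure X) ∈ invMeasures f :=
    ⟨inferInstance, fun B hB => by rw [← Measure.map_apply hf.measurable hB, hmap]⟩
  have hge : η ≤ ∫ y, g y ∂(ν : Measure X) := by
    refine ge_of_tendsto (hlim g hg) (h𝒰x.mono fun n hn => ?_)
    rw [le_inv_mul_iff₀ (by positivity)]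
    exact hn.le
  linarith [hgM _ hνM]

theorem exists_forall_birkhoff_le [CompactSpace X] {f : X → X} (hf : Continuous f) {g : X → ℝ}
    (hg : Continuous g) (hgM : ∀ ν ∈ invMeasures f, ∫ y, g y ∂ν ≤ 0) {η : ℝ} (hη : 0 < η) :
    ∃ C, ∀ n x, birkhoff f g n x ≤ n * η + C := by
  obtain ⟨N, hN⟩ := eventually_atTop.1 (eventually_birkhoff_succ_le hf hg hgM hη)
  obtain ⟨D, hD, hgD⟩ := exists_pos_forall_abs_le hg
  refine ⟨N * D, fun n x => ?_⟩
  rcases Nat.lt_or_ge N n with h | h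
  · obtain ⟨l, rfl⟩ : ∃ l, n = l + 1 := ⟨n - 1, by omega⟩
    have := hN l (by omega) x
    push_cast
    have : 0 ≤ N * D := by positivity
    linarith
  · have h1 := birkhoff_le_mul (f := f) (fun x => (le_abs_self _).trans (hgD x)) n x
    have h2 : (n : ℝ) * D ≤ N * D := by gcongr
    have : 0 ≤ n * η := by positivity
    linarith

end EmpiricalMeasure

theorem mem_equilibriumStates_iff [MetricSpace X] [MeasurableSpace X] {f : X → X} {φ ψ : X → ℝ} {μ : Measure X}
    (hμ : μ ∈ invMeasures f) {h : ℝ} (hh : measEntropy f μ = h) :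
    μ ∈ equilibriumStates f ψ φ ↔
      inducedPressure f ψ φ = (((h + ∫ x, φ x ∂μ) / ∫ x, ψ x ∂μ : ℝ) : EReal) := by
  rw [equilibriumStates, Set.mem_ofPred_eq, hh, EReal.coe_div, EReal.coe_add]
  exact and_iff_right hμ

theorem measEntropy_nonneg [MeasurableSpace X] (f : X → X) (μ : Measure X)
    [IsProbabilityMeasure μ] :
    0 ≤ measEntropy f μ := by
  refine le_iSup_of_le 1 (le_iSup_of_le (fun _ => 0) (le_iSup_of_le measurable_const ?_))
  refine le_liminf_of_le (h := Eventually.of_forall fun n => ?_)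
  rw [← EReal.coe_zero, EReal.coe_le_coe_iff]
  refine mul_nonneg (by positivity) (Finset.sum_nonneg fun s _ => ?_)
  exact Real.negMulLog_nonneg ENNReal.toReal_nonneg measureReal_le_one

section Freezing
variable [MetricSpace X] [MeasurableSpace X] [BorelSpace X]

theorem inducedPressure_mul_le [CompactSpace X] [Nonempty X] {f : X → X} (hf : Continuous f)
    {φ ψ : X → ℝ} (hφ : Continuous φ) (hψ : Continuous ψ) (hψpos : ∀ x, 0 < ψ x) {M c β : ℝ}
    (hM : ∀ ν ∈ invMeasures f, ∫ x, φ x ∂ν ≤ M * ∫ x, ψ x ∂ν)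
    (hc : inducedPressure f ψ φ < c) (hβ : 1 ≤ β) :
    inducedPressure f ψ (fun x => β * φ x) ≤ ((c + (β - 1) * M : ℝ) : EReal) := by
  refine EReal.le_of_forall_lt_iff_le.1 fun z hz => ?_
  rw [EReal.coe_lt_coe_iff] at hz
  obtain ⟨s, hs, rfl⟩ : ∃ s, 0 ≤ s ∧ β = 1 + s := ⟨β - 1, by linarith, by ring⟩
  rw [add_sub_cancel_left] at hz
  obtain ⟨δ, hδ, rfl⟩ : ∃ δ > 0, z = c + s * M + δ := ⟨z - (c + s * M), by linarith, by ring⟩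
  obtain ⟨m, hm, hψm⟩ := exists_pos_forall_le hψ hψpos
  obtain ⟨D, hD, hψD⟩ := exists_pos_forall_abs_le hψ
  obtain ⟨η, hη, hηδ⟩ : ∃ η > 0, s * (2 * η / m) ≤ δ / 2 := by
    refine ⟨δ * m / (4 * (s + 1)), by positivity, ?_⟩
    have : s * (2 * (δ * m / (4 * (s + 1))) / m) = (s / (s + 1)) * (δ / 2) := by
      field_simp
      ring
    rw [this]
    exact mul_le_of_le_one_left (by positivity) ((div_le_one (by positivity)).2 (by linarith))
  obtain ⟨C, hC⟩ := exists_forall_birkhoff_le hf (g := fun y => φ y - M * ψ y) (by fun_prop)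
    (fun ν hν => by
      have := hν.1
      rw [integral_sub (integrable_of_continuous ν hφ)
        ((integrable_of_continuous ν hψ).const_mul M), integral_const_mul]
      linarith [hM ν hν]) hη
  refine inducedPressure_le ?_
  filter_upwards [eventually_forall_dist_le_abs_sub_le hφ hη, eventually_inducedQ_lt hc]
    with ε hεφ hεQ
  filter_upwards [hεQ, eventually_ge_atTop (s * (|M| * D + C) / (δ / 2)), eventually_ge_atTop 0]
    with T hT hTbig hT0
  rw [div_le_iff₀ (by positivity)] at hTbig
  obtain ⟨F, hFspan, hFuse, hFsum⟩ := exists_spanning_of_inducedQ_lt hT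
  have hpt : ∀ n, ∀ x ∈ F n, birkhoff f φ n x ≤ M * T + 2 * η / m * T + (|M| * D + C) := by
    intro n x hx
    obtain ⟨y, hy, hxy⟩ := hFuse n x hx
    have h1 := (abs_le.1 (abs_birkhoff_sub_le hεφ hxy)).2
    have h2 := hC n y
    rw [birkhoff_sub_const_mul] at h2
    have h3 : |birkhoff f ψ n y - T| ≤ D := by
      have h4 := hy.2
      rw [birkhoff_succ] at h4
      have h5 := (abs_le.1 (hψD (f^[n] y))).2
      rw [abs_le]
      constructor <;> linarith [hy.1]
    have h6 : M * (birkhoff f ψ n y - T) ≤ |M| * D := by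
      refine (le_abs_self _).trans ?_
      rw [abs_mul]
      exact mul_le_mul_of_nonneg_left h3 (abs_nonneg M)
    have h7 : n * η ≤ η / m * T := by
      have h8 := (mul_le_birkhoff hψm n y).trans hy.1
      rw [div_mul_eq_mul_div, le_div_iff₀ hm]
      have := mul_le_mul_of_nonneg_left h8 hη.le
      linarith
    have h9 : 2 * η / m * T = η / m * T + η / m * T := by ring
    linarith
  set R : ℝ := s * (M * T + 2 * η / m * T + (|M| * D + C)) with hR
  calc inducedQ f ψ (fun x => (1 + s) * φ x) T ε
      ≤ ∑' n : inducedST f ψ T, ∑ x ∈ F n,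
          ENNReal.ofReal (Real.exp (birkhoff f (fun x => (1 + s) * φ x) n x)) :=
        iInf₂_le F hFspan
    _ ≤ ∑' n : inducedST f ψ T, (∑ x ∈ F n, ENNReal.ofReal (Real.exp (birkhoff f φ n x))) *
          ENNReal.ofReal (Real.exp R) := by
        refine ENNReal.tsum_le_tsum fun n => ?_
        rw [Finset.sum_mul]
        refine Finset.sum_le_sum fun x hx => ?_
        rw [← ENNReal.ofReal_mul (Real.exp_pos _).le, ← Real.exp_add]
        refine ENNReal.ofReal_le_ofReal (Real.exp_le_exp.2 ?_)
        have h1 : birkhoff f (fun x => (1 + s) * φ x) n x = (1 + s) * birkhoff f φ n x := by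
          simp [birkhoff, Finset.mul_sum]
        have h2 := mul_le_mul_of_nonneg_left (hpt n x hx) hs
        rw [h1]
        linarith
    _ ≤ ENNReal.ofReal (Real.exp (c * T)) * ENNReal.ofReal (Real.exp R) := by
        rw [ENNReal.tsum_mul_right]
        gcongr
    _ ≤ ENNReal.ofReal (Real.exp ((c + s * M + δ) * T)) := by
        rw [← ENNReal.ofReal_mul (Real.exp_pos _).le, ← Real.exp_add]
        refine ENNReal.ofReal_le_ofReal (Real.exp_le_exp.2 ?_)
        have h1 := mul_le_mul_of_nonneg_right hηδ hT0
        linarith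

theorem exists_measEntropy_eq_coe [CompactSpace X] [Nonempty X] {f : X → X} (hf : Continuous f)
    (htop : topEntropy f < ⊤) {μ : Measure X} (hμ : μ ∈ invMeasures f) :
    ∃ h : ℝ, 0 ≤ h ∧ measEntropy f μ = h := by
  have := hμ.1
  obtain ⟨c, hc, -⟩ := EReal.lt_iff_exists_real_btwn.1 htop
  have h1 := measEntropy_le_of_inducedPressure_lt hf continuous_const continuous_const
    (fun _ => one_pos) hμ hc
  have h0 := measEntropy_nonneg f μ
  lift measEntropy f μ to ℝ using
    ⟨(h1.trans_lt (EReal.coe_lt_top _)).ne, (EReal.bot_lt_zero.trans_le h0).ne'⟩ with h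
  exact ⟨h, by exact_mod_cast h0, rfl⟩

theorem div_integral_le_inducedPressure [CompactSpace X] [Nonempty X] {f : X → X}
    (hf : Continuous f) {φ ψ : X → ℝ} (hφ : Continuous φ) (hψ : Continuous ψ)
    (hψpos : ∀ x, 0 < ψ x) {μ : Measure X} (hμ : μ ∈ invMeasures f) {h : ℝ}
    (hh : measEntropy f μ = h) (hint : 0 < ∫ x, ψ x ∂μ) :
    (((h + ∫ x, φ x ∂μ) / ∫ x, ψ x ∂μ : ℝ) : EReal) ≤ inducedPressure f ψ φ := by
  refine EReal.le_of_forall_lt_iff_le.1 fun c hc => ?_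
  have h1 := measEntropy_le_of_inducedPressure_lt hf hφ hψ hψpos hμ hc
  rw [hh, EReal.coe_le_coe_iff] at h1
  rw [EReal.coe_le_coe_iff, div_le_iff₀ hint]
  linarith

end Freezing

/-- A non-empty `F ⊆ M(X,f)` is the set of equilibrium states of
`P_ψ(βφ)` for all `β ≥ 1` iff (1) `F` is the set of equilibrium states of `P_ψ(φ)` and
(2) every `μ ∈ F` maximizes `(∫φ dμ)/(∫ψ dμ)` over `M(X,f)`. -/
theorem freezing_equivalent_conditions
    {X : Type*} [MetricSpace X] [CompactSpace X] [Nonempty X]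
    [MeasurableSpace X] [BorelSpace X]
    (f : X → X) (hf : Continuous f)
    (φ ψ : X → ℝ) (hφ : Continuous φ) (hψ : Continuous ψ) (hψpos : ∀ x, 0 < ψ x)
    (htop : topEntropy f < ⊤)
    (F : Set (Measure X)) (hFne : F.Nonempty) (hFM : F ⊆ invMeasures f) :
    (∀ β : ℝ, 1 ≤ β → equilibriumStates f ψ (fun x => β * φ x) = F) ↔
      (equilibriumStates f ψ φ = F ∧
        ∀ μ ∈ F, (∫ x, φ x ∂μ) / (∫ x, ψ x ∂μ) = maxRatio f ψ φ) := by
  obtain ⟨m, hm, hψm⟩ := exists_pos_forall_le hψ hψpos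
  have hψge : ∀ ν ∈ invMeasures f, m ≤ ∫ x, ψ x ∂ν := by
    intro ν hν
    have := hν.1
    simpa using integral_mono (integrable_const m) (integrable_of_continuous ν hψ) hψm
  have hψi : ∀ ν ∈ invMeasures f, 0 < ∫ x, ψ x ∂ν := fun ν hν => hm.trans_le (hψge ν hν)
  choose! H hH0 hH using fun (ν : Measure X) (hν : ν ∈ invMeasures f) =>
    exists_measEntropy_eq_coe hf htop hν
  have hβφ : ∀ β : ℝ, Continuous (fun x => β * φ x) := fun β => hφ.const_mul β
  have hlow : ∀ β : ℝ, ∀ ν ∈ invMeasures f,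
      (((H ν + β * ∫ x, φ x ∂ν) / ∫ x, ψ x ∂ν : ℝ) : EReal) ≤
        inducedPressure f ψ (fun x => β * φ x) := by
    intro β ν hν
    have := div_integral_le_inducedPressure hf (hβφ β) hψ hψpos hν (hH ν hν) (hψi ν hν)
    rwa [integral_const_mul] at this
  have hmem : ∀ β : ℝ, ∀ ν ∈ invMeasures f, (ν ∈ equilibriumStates f ψ (fun x => β * φ x) ↔
      inducedPressure f ψ (fun x => β * φ x) =
        (((H ν + β * ∫ x, φ x ∂ν) / ∫ x, ψ x ∂ν : ℝ) : EReal)) := by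
    intro β ν hν
    rw [mem_equilibriumStates_iff hν (hH ν hν), integral_const_mul]
  obtain ⟨C, hC, hφC⟩ := exists_pos_forall_abs_le hφ
  have hbdd : BddAbove (range fun ν : invMeasures f =>
      (∫ x, φ x ∂(ν : Measure X)) / (∫ x, ψ x ∂(ν : Measure X))) := by
    refine ⟨C / m, ?_⟩
    rintro _ ⟨⟨ν, hν⟩, rfl⟩
    have := hν.1
    have h1 : ∫ x, φ x ∂ν ≤ C := by
      simpa using integral_mono (integrable_of_continuous ν hφ) (integrable_const C)
        fun x => (le_abs_self _).trans (hφC x)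
    exact div_le_div₀ hC.le h1 hm (hψge ν hν)
  have hmax : ∀ ν ∈ invMeasures f, (∫ x, φ x ∂ν) / (∫ x, ψ x ∂ν) ≤ maxRatio f ψ φ :=
    fun ν hν => le_ciSup hbdd ⟨ν, hν⟩
  constructor
  · intro h
    have h1 := h 1 le_rfl
    simp only [one_mul] at h1
    refine ⟨h1, fun μ hμ => le_antisymm (hmax μ (hFM hμ)) ?_⟩
    have : Nonempty (invMeasures f) := ⟨⟨μ, hFM hμ⟩⟩
    refine ciSup_le fun ⟨ν, hν⟩ => ?_
    by_contra! hlt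
    simp only at hlt
    set bμ := (∫ x, φ x ∂μ) / (∫ x, ψ x ∂μ) with hbμ
    set bν := (∫ x, φ x ∂ν) / (∫ x, ψ x ∂ν) with hbν
    obtain ⟨β, hβ1, hβ2⟩ : ∃ β ≥ 1, H μ / (∫ x, ψ x ∂μ) < β * (bν - bμ) := by
      refine ⟨max 1 (H μ / (∫ x, ψ x ∂μ) / (bν - bμ) + 1), le_max_left _ _, ?_⟩
      rw [← div_lt_iff₀ (by linarith)]
      exact (lt_add_one _).trans_le (le_max_right _ _)
    have h2 := hlow β ν hν
    rw [(hmem β μ (hFM hμ)).1 ((h β hβ1).symm ▸ hμ), EReal.coe_le_coe_iff, add_div, add_div,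
      mul_div_assoc, mul_div_assoc] at h2
    have h3 := div_nonneg (hH0 ν hν) (hψi ν hν).le
    linarith
  · rintro ⟨hF, hFmax⟩ β hβ
    obtain ⟨μ₀, hμ₀⟩ := hFne
    set M := maxRatio f ψ φ with hM
    have hmem1 : ∀ ν ∈ invMeasures f, (ν ∈ F ↔ inducedPressure f ψ φ =
        (((H ν + ∫ x, φ x ∂ν) / ∫ x, ψ x ∂ν : ℝ) : EReal)) := by
      intro ν hν
      rw [← hF]
      exact mem_equilibriumStates_iff hν (hH ν hν)
    set a : Measure X → ℝ := fun ν => H ν / ∫ x, ψ x ∂ν with ha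
    have hP1 : inducedPressure f ψ φ = ((a μ₀ + M : ℝ) : EReal) := by
      rw [(hmem1 μ₀ (hFM hμ₀)).1 hμ₀, add_div, hFmax μ₀ hμ₀]
    have hPβ : inducedPressure f ψ (fun x => β * φ x) = ((a μ₀ + β * M : ℝ) : EReal) := by
      apply le_antisymm
      · refine EReal.le_of_forall_lt_iff_le.1 fun z hz => ?_
        rw [EReal.coe_lt_coe_iff] at hz
        have h1 := inducedPressure_mul_le (c := z - (β - 1) * M) (M := M) hf hφ hψ hψpos
          (fun ν hν => (div_le_iff₀ (hψi ν hν)).1 (hmax ν hν))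
          (by rw [hP1, EReal.coe_lt_coe_iff]; linarith) hβ
        simpa using h1
      · have h1 := hlow β μ₀ (hFM hμ₀)
        rwa [add_div, mul_div_assoc, hFmax μ₀ hμ₀] at h1
    ext ν
    constructor
    · intro hν
      have hνM : ν ∈ invMeasures f := hν.1
      have h1 := (hmem β ν hνM).1 hν
      have h2 := hlow 1 ν hνM
      simp only [one_mul] at h2
      rw [hmem1 ν hνM]
      refine le_antisymm ?_ h2
      rw [hP1, EReal.coe_le_coe_iff, add_div]
      rw [hPβ, EReal.coe_eq_coe_iff, add_div, mul_div_assoc] at h1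
      have h3 := mul_le_mul_of_nonneg_left (hmax ν hνM) (sub_nonneg.2 hβ)
      simp only [ha] at h1 ⊢
      linarith
    · intro hν
      have hνM := hFM hν
      have h1 := (hmem1 ν hνM).1 hν
      rw [hP1, EReal.coe_eq_coe_iff, add_div, hFmax ν hν] at h1
      rw [hmem β ν hνM, hPβ, EReal.coe_eq_coe_iff, add_div, mul_div_assoc, hFmax ν hν]
      linarith
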